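/- Let f : ℝ → ℝ be continuous with compact support, and for t > 0 define the scale-space representation L(x, t) = ∫_ℝ f(x − y) · (1/√(2πt))·exp(-y²/(2t)) dy. Then for all 0 < t₁ ≤ t₂, if the set of strict local minimum points of x ↦ L(x, t₁) is finite, the set of strict local minimum points of x ↦ L(x, t₂) is also finite and its cardinality is at most that of the set of strict local minimum points of x ↦ L(x, t₁). -/

import Mathlib

open Real MeasureTheory

/-- The set of strict local minimum points of `h : ℝ → ℝ`: points `x₀` such
that `h x₀ < h x` for all `x ≠ x₀` in some neighborhood of `x₀`. -/
def strictLocalMinSet (h : ℝ → ℝ) : Set ℝ :=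
  {x₀ | ∀ᶠ x in nhdsWithin x₀ {x₀}ᶜ, h x₀ < h x}


/-- `AlternatesAbove k w b`: there are points `b < x₁ < ⋯ < x_k` at which `w` takes nonzero values
of alternating sign, the first one positive. -/
def AlternatesAbove : ℕ → (ℝ → ℝ) → ℝ → Prop
  | 0, _, _ => True
  | k + 1, w, b => ∃ x, b < x ∧ 0 < w x ∧ AlternatesAbove k (fun y => -w y) x

namespace AlternatesAbove

theorem anti {k : ℕ} {w : ℝ → ℝ} {b c : ℝ} (h : AlternatesAbove k w c) (hbc : b ≤ c) :
    AlternatesAbove k w b := by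
  cases k with
  | zero => trivial
  | succ k =>
    obtain ⟨x, hx, h⟩ := h
    exact ⟨x, hbc.trans_lt hx, h⟩

theorem map {k : ℕ} {w v φ : ℝ → ℝ} {b : ℝ} (h : AlternatesAbove k w b) (hφ : StrictMono φ)
    (hpos : ∀ x, b < x → 0 < w x → 0 < v (φ x)) (hneg : ∀ x, b < x → w x < 0 → v (φ x) < 0) :
    AlternatesAbove k v (φ b) := by
  induction k generalizing w v b with
  | zero => trivial
  | succ k ih =>
    obtain ⟨x, hx, hwx, h⟩ := h
    refine ⟨φ x, hφ hx, hpos x hx hwx, ih h ?_ ?_⟩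
    · intro y hy hw
      have := hneg y (hx.trans hy) (by linarith)
      linarith
    · intro y hy hw
      have := hpos y (hx.trans hy) (by linarith)
      linarith

theorem congr_sign {k : ℕ} {w v : ℝ → ℝ} {b : ℝ} (h : AlternatesAbove k w b)
    (hpos : ∀ x, b < x → 0 < w x → 0 < v x) (hneg : ∀ x, b < x → w x < 0 → v x < 0) :
    AlternatesAbove k v b :=
  h.map (φ := id) strictMono_id hpos hneg

/-- Each pair of consecutive alternating values of `G` produces a value of its derivative with the
sign of the second one. -/
theorem neg_deriv {k : ℕ} {G G' : ℝ → ℝ} (hG : ∀ x, HasDerivAt G (G' x) x) {x : ℝ}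
    (hx : 0 < G x) (h : AlternatesAbove k (fun y => -G y) x) :
    AlternatesAbove k (fun y => -G' y) x := by
  induction k generalizing G G' x with
  | zero => trivial
  | succ k ih =>
    obtain ⟨z, hxz, hz, h⟩ := h
    obtain ⟨ξ, ⟨hξ₁, hξ₂⟩, hξ⟩ := exists_hasDerivAt_eq_slope G G' hxz
      (fun y _ => (hG y).continuousAt.continuousWithinAt) (fun y _ => hG y)
    refine ⟨ξ, hξ₁, ?_, (ih (fun y => (hG y).neg) hz h).anti hξ₂.le⟩
    have : G' ξ < 0 := by
      rw [hξ]
      exact div_neg_of_neg_of_pos (by linarith) (by linarith)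
    linarith

end AlternatesAbove

/-- `w` decays fast enough for its two-sided Laplace transform to exist everywhere. -/
def ExpIntegrable (w : ℝ → ℝ) : Prop :=
  ∀ x : ℝ, Integrable fun y => exp (x * y) * w y

namespace ExpIntegrable

variable {w : ℝ → ℝ}

theorem aestronglyMeasurable (hw : ExpIntegrable w) : AEStronglyMeasurable w volume := by
  simpa using (hw 0).aestronglyMeasurable

theorem neg (hw : ExpIntegrable w) : ExpIntegrable fun y => -w y := fun x => by
  simpa using (hw x).neg

theorem abs_mul_exp_le {a x y r : ℝ} (hr : |x - a| ≤ r) :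
    |y| * exp (x * y) ≤ exp ((a + (r + 1)) * y) + exp ((a - (r + 1)) * y) := by
  obtain ⟨h₁, h₂⟩ := abs_le.1 hr
  have key : |y| * exp (x * y) ≤ exp (|y| + x * y) := by
    rw [exp_add]
    gcongr
    linarith [add_one_le_exp |y|]
  refine key.trans ?_
  rcases le_total 0 y with hy | hy
  · rw [abs_of_nonneg hy]
    have : exp (y + x * y) ≤ exp ((a + (r + 1)) * y) := exp_le_exp.2 (by nlinarith)
    linarith [exp_pos ((a - (r + 1)) * y)]
  · rw [abs_of_nonpos hy]
    have : exp (-y + x * y) ≤ exp ((a - (r + 1)) * y) := exp_le_exp.2 (by nlinarith)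
    linarith [exp_pos ((a + (r + 1)) * y)]

theorem integrable_bound (hw : ExpIntegrable w) (a r : ℝ) :
    Integrable fun y => (exp ((a + (r + 1)) * y) + exp ((a - (r + 1)) * y)) * |w y| := by
  have h := (hw (a + (r + 1))).norm.add (hw (a - (r + 1))).norm
  refine h.congr (Filter.Eventually.of_forall fun y => ?_)
  simp [add_mul]

theorem id_mul (hw : ExpIntegrable w) : ExpIntegrable fun y => y * w y := fun x => by
  refine (hw.integrable_bound x 0).mono' ?_ (Filter.Eventually.of_forall fun y => ?_)
  · exact (by fun_prop : Continuous fun y => exp (x * y)).aestronglyMeasurable.mul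
      (continuous_id.aestronglyMeasurable.mul hw.aestronglyMeasurable)
  · have := abs_mul_exp_le (a := x) (x := x) (y := y) (r := 0) (by simp)
    calc ‖exp (x * y) * (y * w y)‖ = |y| * exp (x * y) * |w y| := by
          simp; ring
      _ ≤ _ := by gcongr

theorem const_sub_mul (hw : ExpIntegrable w) (c : ℝ) : ExpIntegrable fun y => (c - y) * w y :=
  fun x => by
    refine (((hw x).const_mul c).sub (hw.id_mul x)).congr (Filter.Eventually.of_forall fun y => ?_)
    simp only [Pi.sub_apply]
    ring

theorem hasDerivAt_complex (hw : ExpIntegrable w) (z : ℂ) :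
    HasDerivAt (fun z : ℂ => ∫ y : ℝ, Complex.exp (z * y) * (w y : ℂ))
      (∫ y : ℝ, Complex.exp (z * y) * ((y * w y : ℝ) : ℂ)) z := by
  have hmeas : AEStronglyMeasurable (fun y => (w y : ℂ)) volume :=
    Complex.continuous_ofReal.comp_aestronglyMeasurable hw.aestronglyMeasurable
  have hexp : ∀ z : ℂ, AEStronglyMeasurable (fun y : ℝ => Complex.exp (z * y)) volume :=
    fun z => (by fun_prop : Continuous fun y : ℝ => Complex.exp (z * y)).aestronglyMeasurable
  refine (hasDerivAt_integral_of_dominated_loc_of_deriv_le (μ := volume)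
    (F := fun (z : ℂ) (y : ℝ) => Complex.exp (z * y) * (w y : ℂ))
    (F' := fun (z : ℂ) (y : ℝ) => Complex.exp (z * y) * ((y * w y : ℝ) : ℂ))
    (bound := fun y => (exp ((z.re + (1 + 1)) * y) + exp ((z.re - (1 + 1)) * y)) * |w y|)
    (Metric.ball_mem_nhds z one_pos) ?_ ?_ ?_ ?_ (hw.integrable_bound z.re 1) ?_).2
  · exact Filter.Eventually.of_forall fun z => (hexp z).mul hmeas
  · refine (hw z.re).norm.mono' ((hexp z).mul hmeas) (Filter.Eventually.of_forall fun y => ?_)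
    simp [Complex.norm_exp]
  · refine (hexp z).mul (Complex.continuous_ofReal.comp_aestronglyMeasurable ?_)
    exact continuous_id.aestronglyMeasurable.mul hw.aestronglyMeasurable
  · refine Filter.Eventually.of_forall fun y x hx => ?_
    have hre : |x.re - z.re| ≤ 1 := by
      rw [← Complex.sub_re]
      exact (Complex.abs_re_le_norm _).trans (by simpa [dist_eq_norm] using (Metric.mem_ball.1 hx).le)
    calc ‖Complex.exp (x * y) * ((y * w y : ℝ) : ℂ)‖ = |y| * exp (x.re * y) * |w y| := by
          simp [Complex.norm_exp]; ring
      _ ≤ _ := by gcongr; exact abs_mul_exp_le hre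
  · refine Filter.Eventually.of_forall fun y x _ => ?_
    have h := (((hasDerivAt_id x).mul_const (y : ℂ)).cexp).mul_const (w y : ℂ)
    refine h.congr_deriv ?_
    push_cast
    simp only [id, one_mul]
    ring

theorem re_complex (w : ℝ → ℝ) (x : ℝ) :
    (∫ y : ℝ, Complex.exp ((x : ℂ) * y) * (w y : ℂ)).re = ∫ y, exp (x * y) * w y := by
  have : (fun y : ℝ => Complex.exp ((x : ℂ) * y) * (w y : ℂ)) =
      fun y : ℝ => ((exp (x * y) * w y : ℝ) : ℂ) := by
    ext y
    push_cast
    rfl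
  rw [this, integral_complex_ofReal, Complex.ofReal_re]

theorem hasDerivAt (hw : ExpIntegrable w) (x : ℝ) :
    HasDerivAt (fun x : ℝ => ∫ y, exp (x * y) * w y) (∫ y, exp (x * y) * (y * w y)) x := by
  have h := (hw.hasDerivAt_complex x).real_of_complex
  rw [re_complex] at h
  simpa only [re_complex] using h

theorem analyticAt (hw : ExpIntegrable w) (x : ℝ) :
    AnalyticAt ℝ (fun x : ℝ => ∫ y, exp (x * y) * w y) x := by
  have h : AnalyticAt ℂ (fun z : ℂ => ∫ y : ℝ, Complex.exp (z * y) * (w y : ℂ)) x :=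
    Differentiable.analyticAt (fun z => (hw.hasDerivAt_complex z).differentiableAt) _
  simpa only [re_complex] using h.re_ofReal

/-- The two-sided Laplace transform is variation diminishing. -/
theorem exists_alternatesAbove (hw : ExpIntegrable w) {k : ℕ} {b : ℝ}
    (h : AlternatesAbove k (fun x => ∫ y, exp (x * y) * w y) b) : ∃ c, AlternatesAbove k w c := by
  induction k generalizing w b with
  | zero => exact ⟨0, trivial⟩
  | succ k ih =>
    obtain ⟨x, -, hx, h⟩ := h
    have hne : {y | 0 < w y}.Nonempty := by
      by_contra! hempty
      refine hx.not_ge (integral_nonpos fun y => ?_)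
      have hy : ¬ 0 < w y := fun hy => (Set.eq_empty_iff_forall_notMem.1 hempty) y hy
      exact mul_nonpos_of_nonneg_of_nonpos (exp_pos _).le (not_lt.1 hy)
    suffices ∃ s, 0 < w s ∧ AlternatesAbove k (fun y => -w y) s by
      obtain ⟨s, hs, h⟩ := this
      exact ⟨s - 1, s, by linarith, hs, h⟩
    by_cases hbdd : BddBelow {y | 0 < w y}
    · set c := sInf {y | 0 < w y}
      have hG : ∀ x, HasDerivAt (fun x => exp (-c * x) * ∫ y, exp (x * y) * w y)
          (-(exp (-c * x) * ∫ y, exp (x * y) * ((c - y) * w y))) x := by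
        intro x
        have h₁ : HasDerivAt (fun x => exp (-c * x)) (exp (-c * x) * -c) x := by
          simpa using ((hasDerivAt_id x).const_mul (-c)).exp
        refine (h₁.mul (hw.hasDerivAt x)).congr_deriv ?_
        have : ∫ y, exp (x * y) * ((c - y) * w y) =
            c * (∫ y, exp (x * y) * w y) - ∫ y, exp (x * y) * (y * w y) := by
          rw [← integral_const_mul, ← integral_sub ((hw x).const_mul c) (hw.id_mul x)]
          congr 1 with y
          ring
        rw [this]
        ring
      have hderiv := AlternatesAbove.neg_deriv hG (x := x) (k := k) (by positivity)
        (h.congr_sign (fun y _ hy => by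
            have := mul_pos (exp_pos (-c * y)) hy
            linarith)
          (fun y _ hy => by
            have := mul_neg_of_pos_of_neg (exp_pos (-c * y)) hy
            linarith))
      obtain ⟨d, hd⟩ := ih (hw.const_sub_mul c) (b := x) (hderiv.congr_sign
        (fun y _ hy => by
          rw [neg_neg] at hy
          exact (mul_pos_iff_of_pos_left (exp_pos _)).1 hy)
        (fun y _ hy => by
          rw [neg_neg] at hy
          exact neg_of_mul_neg_right hy (exp_pos _).le))
      cases k with
      | zero =>
        obtain ⟨s, hs⟩ := hne
        exact ⟨s, hs, trivial⟩
      | succ k =>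
        obtain ⟨y, -, hy, h'⟩ := hd
        have hcy : c < y := by
          by_contra! hle
          rcases hle.lt_or_eq with hlt | rfl
          · have hwy : 0 < w y := (mul_pos_iff_of_pos_left (by linarith)).1 hy
            exact (csInf_le hbdd hwy).not_gt hlt
          · simp at hy
        obtain ⟨s, hs, hsy⟩ := exists_lt_of_csInf_lt hne hcy
        refine ⟨s, hs, y, hsy, ?_, h'.congr_sign ?_ ?_⟩
        · nlinarith
        · intro z hz hwz
          have : c < z := hcy.trans hz
          nlinarith
        · intro z hz hwz
          have : c < z := hcy.trans hz
          nlinarith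
    · obtain ⟨d, hd⟩ := ih hw.neg (b := x) (by
        simpa only [mul_neg, integral_neg] using h)
      obtain ⟨s, hs, hsd⟩ := not_bddBelow_iff.1 hbdd d
      exact ⟨s, hs, hd.anti hsd.le⟩

end ExpIntegrable

open Filter Topology in
theorem exists_isLocalMin_mem_Ioo {h h' : ℝ → ℝ} (hh : ∀ x, HasDerivAt h (h' x) x) {a b : ℝ}
    (hab : a < b) (ha : h' a < 0) (hb : 0 < h' b) : ∃ z ∈ Set.Ioo a b, IsLocalMin h z := by
  have hcont : Continuous h := continuous_iff_continuousAt.2 fun x => (hh x).continuousAt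
  obtain ⟨z, hz, hmin⟩ := isCompact_Icc.exists_isMinOn (Set.nonempty_Icc.2 hab.le)
    hcont.continuousOn
  have hza : z ≠ a := by
    rintro rfl
    have h₁ : ∀ᶠ y in 𝓝[>] z, slope h z y < 0 :=
      ((hasDerivAt_iff_tendsto_slope.1 (hh z)).mono_left
        (nhdsWithin_mono _ fun y (hy : z < y) => hy.ne')).eventually (gt_mem_nhds ha)
    obtain ⟨y, hy₁, hy₂, hy₃⟩ := (h₁.and (Ioo_mem_nhdsGT hab)).exists
    have := hmin (Set.mem_Icc.2 ⟨hy₂.le, hy₃.le⟩)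
    rw [slope_def_field] at hy₁
    exact hy₁.not_ge (div_nonneg (sub_nonneg.2 this) (by linarith))
  have hzb : z ≠ b := by
    rintro rfl
    have h₁ : ∀ᶠ y in 𝓝[<] z, 0 < slope h z y :=
      ((hasDerivAt_iff_tendsto_slope.1 (hh z)).mono_left
        (nhdsWithin_mono _ fun y (hy : y < z) => hy.ne)).eventually (lt_mem_nhds hb)
    obtain ⟨y, hy₁, hy₂, hy₃⟩ := (h₁.and (Ioo_mem_nhdsLT hab)).exists
    have := hmin (Set.mem_Icc.2 ⟨hy₂.le, hy₃.le⟩)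
    rw [slope_def_field] at hy₁
    exact hy₁.not_ge (div_nonpos_of_nonneg_of_nonpos (sub_nonneg.2 this) (by linarith))
  have hzI : z ∈ Set.Ioo a b := ⟨lt_of_le_of_ne hz.1 hza.symm, lt_of_le_of_ne hz.2 hzb⟩
  exact ⟨z, hzI, hmin.isLocalMin (Icc_mem_nhds hzI.1 hzI.2)⟩

/-- A local minimum of a nonconstant real analytic function is strict. -/
theorem IsLocalMin.mem_strictLocalMinSet {h : ℝ → ℝ} (hh : ∀ x, AnalyticAt ℝ h x)
    (hconst : ∀ C, h ≠ fun _ => C) {z : ℝ} (hz : IsLocalMin h z) : z ∈ strictLocalMinSet h := by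
  rcases (hh z).eventually_eq_or_eventually_ne (analyticAt_const (v := h z)) with heq | hne
  · exact absurd (AnalyticOnNhd.eq_of_eventuallyEq (fun x _ => hh x)
      (fun x _ => analyticAt_const) heq) (hconst (h z))
  · have hz' : ∀ᶠ x in nhdsWithin z {z}ᶜ, h z ≤ h x := hz.filter_mono nhdsWithin_le_nhds
    filter_upwards [hne, hz'] with x hx₁ hx₂
    exact lt_of_le_of_ne hx₂ hx₁.symm

theorem AlternatesAbove.exists_finset_strictLocalMinSet {h h' : ℝ → ℝ}
    (hh : ∀ x, HasDerivAt h (h' x) x) (han : ∀ x, AnalyticAt ℝ h x) {n : ℕ} {b : ℝ}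
    (halt : AlternatesAbove (2 * n) (fun x => -h' x) b) :
    ∃ T : Finset ℝ, (∀ x ∈ T, b < x ∧ x ∈ strictLocalMinSet h) ∧ T.card = n := by
  induction n generalizing b with
  | zero => exact ⟨∅, by simp, rfl⟩
  | succ n ih =>
    obtain ⟨p, hbp, hp, q, hpq, hq, halt⟩ := halt
    simp only [neg_neg] at hq halt
    obtain ⟨T, hT, hcard⟩ := ih halt
    obtain ⟨z, hz, hmin⟩ := exists_isLocalMin_mem_Ioo hh hpq (by linarith) hq
    have hconst : ∀ C, h ≠ fun _ => C := by
      rintro C rfl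
      have := (hh q).unique (hasDerivAt_const q C)
      linarith
    have hzT : z ∉ T := fun hmem => (hT z hmem).1.not_gt hz.2
    refine ⟨insert z T, ?_, by rw [Finset.card_insert_of_notMem hzT, hcard]⟩
    intro x hx
    rcases Finset.mem_insert.1 hx with rfl | hx
    · exact ⟨hbp.trans hz.1, hmin.mem_strictLocalMinSet han hconst⟩
    · exact ⟨hbp.trans (hpq.trans (hT x hx).1), (hT x hx).2⟩

open Filter Topology in
theorem alternatesAbove_of_finset_strictLocalMinSet {h h' : ℝ → ℝ}
    (hh : ∀ x, HasDerivAt h (h' x) x) (T : Finset ℝ) (hT : ∀ x ∈ T, x ∈ strictLocalMinSet h)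
    {b : ℝ} (hb : ∀ x ∈ T, b < x) : AlternatesAbove (2 * T.card) (fun x => -h' x) b := by
  induction T using Finset.induction_on_min generalizing b with
  | empty => trivial
  | insert m T hm ih =>
    rw [Finset.card_insert_of_notMem fun hmem => (hm m hmem).false]
    have hmin : ∀ᶠ y in 𝓝[≠] m, h m < h y := hT m (Finset.mem_insert_self m T)
    have hleft : ∀ᶠ y in 𝓝[<] m, h m < h y :=
      hmin.filter_mono (nhdsWithin_mono m fun y (hy : y < m) => hy.ne)
    have hright : ∀ᶠ y in 𝓝[>] m, h m < h y :=
      hmin.filter_mono (nhdsWithin_mono m fun y (hy : m < y) => hy.ne')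
    obtain ⟨p, hp, hbp, hpm⟩ :=
      (hleft.and (Ioo_mem_nhdsLT (hb m (Finset.mem_insert_self m T)))).exists
    have hlt : ∀ᶠ y in 𝓝[>] m, ∀ x ∈ T, y < x :=
      (T.eventually_all.2 fun x hx => gt_mem_nhds (hm x hx)).filter_mono nhdsWithin_le_nhds
    obtain ⟨q, ⟨hq, hqT⟩, hmq⟩ := ((hright.and hlt).and self_mem_nhdsWithin).exists
    have hslope : ∀ {c d : ℝ}, c < d → ∃ ξ ∈ Set.Ioo c d, h' ξ = (h d - h c) / (d - c) :=
      fun hcd => exists_hasDerivAt_eq_slope h h' hcd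
        (fun y _ => (hh y).continuousAt.continuousWithinAt) (fun y _ => hh y)
    obtain ⟨ξ, hξ, hξ'⟩ := hslope hpm
    obtain ⟨η, hη, hη'⟩ := hslope hmq
    refine ⟨ξ, hbp.trans hξ.1, ?_, η, hξ.2.trans hη.1, ?_, ?_⟩
    · simp only [hξ', neg_pos]
      exact div_neg_of_neg_of_pos (by linarith) (by linarith)
    · simp only [hη', neg_neg]
      exact div_pos (by linarith) (by linarith)
    · simp only [neg_neg]
      exact ih (fun x hx => hT x (Finset.mem_insert_of_mem hx)) fun x hx => hη.2.trans (hqT x hx)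

open ProbabilityTheory
open scoped NNReal

/-- The convolution of `u` with the centered Gaussian of variance `v`. -/
noncomputable def gaussianSmoothing (v : ℝ≥0) (u : ℝ → ℝ) (x : ℝ) : ℝ :=
  ∫ y, u (x - y) ∂gaussianReal 0 v

section gaussianSmoothing

variable {u u' : ℝ → ℝ} {v : ℝ≥0} {C : ℝ}

theorem gaussianSmoothing_eq_integral (hv : v ≠ 0) (x : ℝ) :
    gaussianSmoothing v u x =
      ∫ y, u (x - y) * ((1 / √(2 * π * v)) * exp (-y ^ 2 / (2 * v))) := by
  rw [gaussianSmoothing, integral_gaussianReal_eq_integral_smul hv]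
  simp [gaussianPDFReal, mul_comm]

theorem gaussianSmoothing_eq_integral_sub (hv : v ≠ 0) (x : ℝ) :
    gaussianSmoothing v u x =
      ∫ y, u y * ((1 / √(2 * π * v)) * exp (-(x - y) ^ 2 / (2 * v))) := by
  rw [gaussianSmoothing_eq_integral hv, ← integral_sub_left_eq_self _ _ x]
  simp

theorem gaussianSmoothing_eq_laplace (hv : v ≠ 0) (x : ℝ) :
    gaussianSmoothing v u x = (1 / √(2 * π * v)) * exp (-x ^ 2 / (2 * v)) *
      ∫ y, exp (x / v * y) * (exp (-y ^ 2 / (2 * v)) * u y) := by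
  have hv' : (v : ℝ) ≠ 0 := NNReal.coe_ne_zero.2 hv
  rw [gaussianSmoothing_eq_integral_sub hv, ← integral_const_mul]
  congr 1 with y
  have : exp (-(x - y) ^ 2 / (2 * v)) =
      exp (-x ^ 2 / (2 * v)) * exp (x / v * y) * exp (-y ^ 2 / (2 * v)) := by
    rw [← exp_add, ← exp_add]
    congr 1
    field_simp
    ring
  rw [this]
  ring

theorem expIntegrable_gaussian_mul (hv : v ≠ 0) (hu : Continuous u) (hC : ∀ x, |u x| ≤ C) :
    ExpIntegrable fun y => exp (-y ^ 2 / (2 * v)) * u y := fun x => by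
  have hv' : 0 < (v : ℝ) := NNReal.coe_pos.2 (pos_iff_ne_zero.2 hv)
  have h : Integrable fun y : ℝ => exp (-(1 / (2 * v)) * y ^ 2 + x * y + 0) := by
    refine (integrable_cexp_quadratic' (b := ((-(1 / (2 * v)) : ℝ) : ℂ)) ?_ x 0).norm.congr ?_
    · rw [Complex.ofReal_re]
      exact neg_neg_of_pos (by positivity)
    · refine Filter.Eventually.of_forall fun y => ?_
      simp only [Complex.norm_exp]
      norm_cast
  refine (h.const_mul C).mono' (by fun_prop) (Filter.Eventually.of_forall fun y => ?_)
  have : exp (-(1 / (2 * v)) * y ^ 2 + x * y + 0) = exp (x * y) * exp (-y ^ 2 / (2 * v)) := by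
    rw [← exp_add]
    congr 1
    ring
  rw [this, norm_mul, norm_mul, norm_of_nonneg (exp_pos _).le, norm_of_nonneg (exp_pos _).le]
  calc exp (x * y) * (exp (-y ^ 2 / (2 * v)) * ‖u y‖)
      ≤ exp (x * y) * (exp (-y ^ 2 / (2 * v)) * C) := by gcongr; exact hC y
    _ = _ := by ring

theorem analyticAt_gaussianSmoothing (hv : v ≠ 0) (hu : Continuous u) (hC : ∀ x, |u x| ≤ C)
    (x : ℝ) : AnalyticAt ℝ (gaussianSmoothing v u) x := by
  rw [funext (gaussianSmoothing_eq_laplace (u := u) hv)]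
  have h₁ : AnalyticAt ℝ (fun x : ℝ => x / v) x := by fun_prop
  have h₂ := ((expIntegrable_gaussian_mul hv hu hC).analyticAt (x / v)).comp_of_eq h₁ rfl
  have h₃ : AnalyticAt ℝ (fun x : ℝ => 1 / √(2 * π * v) * exp (-x ^ 2 / (2 * v))) x := by fun_prop
  exact h₃.mul h₂

/-- Gaussian smoothing is variation diminishing. -/
theorem exists_alternatesAbove_of_gaussianSmoothing (hv : v ≠ 0) (hu : Continuous u)
    (hC : ∀ x, |u x| ≤ C) {k : ℕ} {b : ℝ} (h : AlternatesAbove k (gaussianSmoothing v u) b) :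
    ∃ c, AlternatesAbove k u c := by
  have hv' : 0 < (v : ℝ) := NNReal.coe_pos.2 (pos_iff_ne_zero.2 hv)
  have hpos : ∀ x : ℝ, 0 < (1 / √(2 * π * v)) * exp (-x ^ 2 / (2 * v)) := fun x => by positivity
  have h₁ := h.map (φ := fun x => x / v)
    (v := fun x => ∫ y, exp (x * y) * (exp (-y ^ 2 / (2 * v)) * u y))
    (fun x y hxy => div_lt_div_of_pos_right hxy hv')
    (fun x _ hx => by
      rw [gaussianSmoothing_eq_laplace hv] at hx
      exact (mul_pos_iff_of_pos_left (hpos x)).1 hx)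
    (fun x _ hx => by
      rw [gaussianSmoothing_eq_laplace hv] at hx
      exact neg_of_mul_neg_right hx (hpos x).le)
  obtain ⟨c, hc⟩ := (expIntegrable_gaussian_mul hv hu hC).exists_alternatesAbove h₁
  exact ⟨c, hc.congr_sign (fun x _ hx => (mul_pos_iff_of_pos_left (exp_pos _)).1 hx)
    (fun x _ hx => neg_of_mul_neg_right hx (exp_pos _).le)⟩

theorem abs_gaussianSmoothing_le (hC : ∀ x, |u x| ≤ C) (x : ℝ) :
    |gaussianSmoothing v u x| ≤ C := by
  simpa [gaussianSmoothing] using norm_integral_le_of_norm_le_const (μ := gaussianReal 0 v)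
    (f := fun y => u (x - y)) (Filter.Eventually.of_forall fun y => hC (x - y))

theorem integrable_gaussianReal_comp_sub (hu : Continuous u) (hC : ∀ x, |u x| ≤ C) (x : ℝ) :
    Integrable (fun y => u (x - y)) (gaussianReal 0 v) :=
  Integrable.of_bound (by fun_prop) C (Filter.Eventually.of_forall fun y => hC (x - y))

theorem gaussianSmoothing_gaussianSmoothing {v₁ v₂ : ℝ≥0} (hu : Continuous u)
    (hC : ∀ x, |u x| ≤ C) :
    gaussianSmoothing v₂ (gaussianSmoothing v₁ u) = gaussianSmoothing (v₂ + v₁) u := by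
  ext x
  simp only [gaussianSmoothing]
  have hconv := gaussianReal_conv_gaussianReal (m₁ := 0) (m₂ := 0) (v₁ := v₂) (v₂ := v₁)
  rw [add_zero] at hconv
  rw [← hconv, integral_conv (by rw [hconv]; exact integrable_gaussianReal_comp_sub hu hC x)]
  simp only [sub_sub]

theorem hasDerivAt_gaussianSmoothing {C' : ℝ} (hu : ∀ x, HasDerivAt u (u' x) x)
    (hC : ∀ x, |u x| ≤ C) (hu' : Continuous u') (hC' : ∀ x, |u' x| ≤ C') (x : ℝ) :
    HasDerivAt (gaussianSmoothing v u) (gaussianSmoothing v u' x) x := by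
  have hcont : Continuous u := continuous_iff_continuousAt.2 fun x => (hu x).continuousAt
  refine (hasDerivAt_integral_of_dominated_loc_of_deriv_le (μ := gaussianReal 0 v)
    (F := fun x y => u (x - y)) (F' := fun x y => u' (x - y)) (bound := fun _ => C')
    Filter.univ_mem ?_ (integrable_gaussianReal_comp_sub hcont hC x) (by fun_prop) ?_
    (integrable_const _) ?_).2
  · exact Filter.Eventually.of_forall fun x => by fun_prop
  · exact Filter.Eventually.of_forall fun y x _ => hC' (x - y)
  · exact Filter.Eventually.of_forall fun y x _ => (hu (x - y)).comp_sub_const x y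

theorem exists_lipschitzWith_gaussian (hv : v ≠ 0) :
    ∃ K : ℝ≥0, LipschitzWith K fun x : ℝ => exp (-x ^ 2 / (2 * v)) := by
  have hv' : 0 < (v : ℝ) := NNReal.coe_pos.2 (pos_iff_ne_zero.2 hv)
  have hderiv : ∀ x : ℝ, HasDerivAt (fun x : ℝ => exp (-x ^ 2 / (2 * v)))
      (exp (-x ^ 2 / (2 * v)) * (-x / v)) x := fun x => by
    refine (((hasDerivAt_pow 2 x).neg.div_const (2 * (v : ℝ))).exp).congr_deriv ?_
    congr 1
    field_simp
    norm_num
  refine ⟨(1 + v / 2) / v,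
    lipschitzWith_of_nnnorm_deriv_le (fun x => (hderiv x).differentiableAt) fun x => ?_⟩
  rw [(hderiv x).deriv, ← NNReal.coe_le_coe, coe_nnnorm]
  push_cast
  have h₁ : |x| ≤ (1 + v / 2) * exp (x ^ 2 / (2 * v)) := by
    have h₂ : |x| ≤ x ^ 2 / (2 * v) + v / 2 := by
      have h₃ : x ^ 2 / (2 * v) + v / 2 - |x| = (|x| - v) ^ 2 / (2 * v) := by
        rw [← sq_abs x]
        field_simp
        ring
      have h₄ : 0 ≤ (|x| - v) ^ 2 / (2 * v) := by positivity
      linarith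
    have h₅ : 0 ≤ x ^ 2 / (2 * v) := by positivity
    nlinarith [add_one_le_exp (x ^ 2 / (2 * v))]
  rw [norm_mul, norm_div, norm_neg, norm_of_nonneg (exp_pos _).le, norm_of_nonneg hv'.le,
    norm_eq_abs, ← mul_div_assoc]
  gcongr
  rw [neg_div, exp_neg, inv_mul_le_iff₀ (exp_pos _)]
  linarith

theorem exists_abs_deriv_gaussianSmoothing_le (hv : v ≠ 0) (hu : Integrable u) :
    ∃ C, ∀ x, |deriv (gaussianSmoothing v u) x| ≤ C := by
  obtain ⟨K, hK⟩ := exists_lipschitzWith_gaussian hv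
  have hint : ∀ x, Integrable fun y => u y * ((1 / √(2 * π * v)) * exp (-(x - y) ^ 2 / (2 * v))) := by
    intro x
    refine hu.mul_bdd (c := 1 / √(2 * π * v)) (by fun_prop)
      (Filter.Eventually.of_forall fun y => ?_)
    rw [norm_of_nonneg (by positivity)]
    refine mul_le_of_le_one_right (by positivity) (exp_le_one_iff.2 ?_)
    exact div_nonpos_of_nonpos_of_nonneg (by nlinarith [sq_nonneg (x - y)]) (by positivity)
  let D : ℝ≥0 := ⟨(∫ y, |u y|) * ((1 / √(2 * π * v)) * K), by positivity⟩
  suffices LipschitzWith D (gaussianSmoothing v u) from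
    ⟨D, fun x => norm_deriv_le_of_lipschitz this⟩
  refine LipschitzWith.of_dist_le_mul fun x z => ?_
  rw [gaussianSmoothing_eq_integral_sub hv, gaussianSmoothing_eq_integral_sub hv, dist_eq_norm,
    ← integral_sub (hint x) (hint z)]
  change _ ≤ (∫ y, |u y|) * ((1 / √(2 * π * v)) * K) * dist x z
  rw [mul_assoc (∫ y, |u y|), ← integral_mul_const]
  refine norm_integral_le_of_norm_le (G := ℝ) (hu.norm.mul_const _)
    (Filter.Eventually.of_forall fun y => ?_)
  rw [← mul_sub, ← mul_sub, norm_mul, norm_mul,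
    norm_of_nonneg (by positivity : 0 ≤ 1 / √(2 * π * v)), norm_eq_abs, mul_assoc _ (K : ℝ)]
  gcongr
  simpa [dist_eq_norm] using hK.dist_le_mul (x - y) (z - y)

end gaussianSmoothing

theorem Set.finite_and_ncard_le_of_forall_finset {α : Type*} {s : Set α} {n : ℕ}
    (h : ∀ T : Finset α, (∀ x ∈ T, x ∈ s) → T.card ≤ n) : s.Finite ∧ s.ncard ≤ n := by
  have hfin : s.Finite := by
    by_contra hinf
    obtain ⟨T, hT, hcard⟩ := Set.Infinite.exists_subset_card_eq hinf (n + 1)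
    have := h T hT
    omega
  refine ⟨hfin, ?_⟩
  rw [Set.ncard_eq_toFinset_card s hfin]
  exact h _ (by simp)

/-- scale-space causality: for a continuous compactly supported
`f : ℝ → ℝ` and the scale-space representation
`L(x,t) = ∫ f(x−y) (1/√(2πt)) exp(-y²/(2t)) dy`, if `0 < t₁ ≤ t₂` and the set
of strict local minimum points of `L(·, t₁)` is finite, then the set of strict
local minimum points of `L(·, t₂)` is finite with cardinality at most that of
the former. -/
theorem scaleSpace_minima_decreasing (f : ℝ → ℝ) (hf : Continuous f)
    (hsupp : HasCompactSupport f)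
    (L : ℝ → ℝ → ℝ)
    (hL : ∀ x t, L x t =
      ∫ y : ℝ, f (x - y) * ((1 / Real.sqrt (2 * π * t)) * Real.exp (-y ^ 2 / (2 * t))))
    (t₁ t₂ : ℝ) (ht₁ : 0 < t₁) (ht₁₂ : t₁ ≤ t₂)
    (hfin : (strictLocalMinSet (fun x => L x t₁)).Finite) :
    (strictLocalMinSet (fun x => L x t₂)).Finite ∧
      (strictLocalMinSet (fun x => L x t₂)).ncard ≤
        (strictLocalMinSet (fun x => L x t₁)).ncard := by
  rcases ht₁₂.eq_or_lt with rfl | hlt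
  · exact ⟨hfin, le_rfl⟩
  obtain ⟨C, hC⟩ := hsupp.exists_bound_of_continuous hf
  lift t₁ to ℝ≥0 using ht₁.le
  lift t₂ to ℝ≥0 using ht₁.le.trans ht₁₂
  have hv₁ : t₁ ≠ 0 := (NNReal.coe_pos.1 ht₁).ne'
  have hv : t₂ - t₁ ≠ 0 := (tsub_pos_of_lt (NNReal.coe_lt_coe.1 hlt)).ne'
  have hv₂ : t₂ ≠ 0 := ((NNReal.coe_pos.1 ht₁).trans (NNReal.coe_lt_coe.1 hlt)).ne'
  have hL₁ : (fun x => L x t₁) = gaussianSmoothing t₁ f :=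
    funext fun x => by rw [hL, gaussianSmoothing_eq_integral hv₁]
  have hL₂ : (fun x => L x t₂) = gaussianSmoothing (t₂ - t₁) (gaussianSmoothing t₁ f) := by
    rw [gaussianSmoothing_gaussianSmoothing hf hC, tsub_add_cancel_of_le (NNReal.coe_le_coe.1 ht₁₂)]
    exact funext fun x => by rw [hL, gaussianSmoothing_eq_integral hv₂]
  rw [hL₁] at hfin
  rw [hL₁, hL₂]
  have han := analyticAt_gaussianSmoothing hv₁ hf hC
  have hd₁ : ∀ x, HasDerivAt (gaussianSmoothing t₁ f) (deriv (gaussianSmoothing t₁ f) x) x :=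
    fun x => (han x).differentiableAt.hasDerivAt
  obtain ⟨C', hC'⟩ :=
    exists_abs_deriv_gaussianSmoothing_le hv₁ (hf.integrable_of_hasCompactSupport hsupp)
  have hcont : Continuous (deriv (gaussianSmoothing t₁ f)) :=
    continuous_iff_continuousAt.2 fun x => (han x).deriv.continuousAt
  have hd₂ := hasDerivAt_gaussianSmoothing (v := t₂ - t₁) hd₁ (abs_gaussianSmoothing_le hC) hcont hC'
  refine Set.finite_and_ncard_le_of_forall_finset fun T hT => ?_
  obtain ⟨b, hb⟩ := T.bddBelow
  have halt := alternatesAbove_of_finset_strictLocalMinSet hd₂ T hT (b := b - 1)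
    fun x hx => (sub_one_lt b).trans_le (hb hx)
  have hneg : (fun x => -gaussianSmoothing (t₂ - t₁) (deriv (gaussianSmoothing t₁ f)) x) =
      gaussianSmoothing (t₂ - t₁) fun x => -deriv (gaussianSmoothing t₁ f) x :=
    funext fun x => by simp [gaussianSmoothing, integral_neg]
  rw [hneg] at halt
  obtain ⟨c, hc⟩ := exists_alternatesAbove_of_gaussianSmoothing hv hcont.neg
    (fun x => (abs_neg _).trans_le (hC' x)) halt
  obtain ⟨S, hS, hcard⟩ := hc.exists_finset_strictLocalMinSet hd₁ han
  rw [← hcard, ← Set.ncard_coe_finset S]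
  exact Set.ncard_le_ncard (fun x hx => (hS x hx).2) hfin
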